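/- arXiv:2109.02939 — 5 statements merged into one kernel-verified Lean document; each statement's English description precedes it below -/
import Mathlib

section
/- Let x₁ ≤ x₂ ≤ … ≤ xₙ be real numbers with n ≥ 1 and let κ ∈ ℂ. Then the determinant of the phase matrix satisfies det Φₙ(κ) = Π_{j=1}^{n−1} (1 − e^{2iκ(x_{j+1} − x_j)}). -/
open Complex Matrix

/-- The phase matrix `Φₙ(κ)` of points `x₁,…,xₙ`, with entries `exp(iκ|x_j − x_ℓ|)`. -/
noncomputable def phaseMatrix (n : ℕ) (x : Fin n → ℝ) (κ : ℂ) :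
    Matrix (Fin n) (Fin n) ℂ :=
  Matrix.of fun j ℓ => Complex.exp (Complex.I * κ * (|x j - x ℓ| : ℝ))

lemma phaseMatrix_apply_of_le {n : ℕ} {x : Fin n → ℝ} (hx : Monotone x) (κ : ℂ) {j l : Fin n}
    (h : l ≤ j) : phaseMatrix n x κ j l = Complex.exp (Complex.I * κ * ((x j - x l : ℝ) : ℂ)) := by
  rw [phaseMatrix, Matrix.of_apply, abs_of_nonneg (sub_nonneg.2 (hx h))]

lemma phaseMatrix_apply_of_ge {n : ℕ} {x : Fin n → ℝ} (hx : Monotone x) (κ : ℂ) {j l : Fin n}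
    (h : j ≤ l) : phaseMatrix n x κ j l = Complex.exp (Complex.I * κ * ((x l - x j : ℝ) : ℂ)) := by
  rw [phaseMatrix, Matrix.of_apply, abs_sub_comm, abs_of_nonneg (sub_nonneg.2 (hx h))]

/-- The phase matrix after subtracting from each row the multiple of the preceding row that
makes the result upper triangular. -/
noncomputable def reducedPhaseMatrix (m : ℕ) (x : Fin (m + 1) → ℝ) (κ : ℂ) :
    Matrix (Fin (m + 1)) (Fin (m + 1)) ℂ :=
  Matrix.of (Fin.cons (phaseMatrix (m + 1) x κ 0) fun i l =>
    phaseMatrix (m + 1) x κ i.succ l -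
      Complex.exp (Complex.I * κ * ((x i.succ - x i.castSucc : ℝ) : ℂ)) *
        phaseMatrix (m + 1) x κ i.castSucc l)

lemma det_phaseMatrix_eq_det_reducedPhaseMatrix (m : ℕ) (x : Fin (m + 1) → ℝ) (κ : ℂ) :
    (phaseMatrix (m + 1) x κ).det = (reducedPhaseMatrix m x κ).det := by
  refine Matrix.det_eq_of_forall_row_eq_smul_add_pred
    (fun i => Complex.exp (Complex.I * κ * ((x i.succ - x i.castSucc : ℝ) : ℂ))) ?_ ?_
  · intro l
    simp [reducedPhaseMatrix]
  · intro i l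
    simp [reducedPhaseMatrix]

lemma reducedPhaseMatrix_isUpperTriangular {m : ℕ} {x : Fin (m + 1) → ℝ} (hx : Monotone x)
    (κ : ℂ) : (reducedPhaseMatrix m x κ).IsUpperTriangular := by
  intro i l hl
  replace hl : l < i := hl
  induction i using Fin.cases with
  | zero => exact absurd hl (Fin.not_lt_zero _)
  | succ i =>
    have h : l ≤ i.castSucc := Fin.le_castSucc_iff.2 hl
    simp only [reducedPhaseMatrix, Matrix.of_apply, Fin.cons_succ]
    rw [phaseMatrix_apply_of_le hx κ (le_of_lt hl), phaseMatrix_apply_of_le hx κ h,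
      ← Complex.exp_add, sub_eq_zero]
    congr 1
    push_cast
    ring

lemma reducedPhaseMatrix_zero_zero (m : ℕ) (x : Fin (m + 1) → ℝ) (κ : ℂ) :
    reducedPhaseMatrix m x κ 0 0 = 1 := by
  simp [reducedPhaseMatrix, phaseMatrix]

lemma reducedPhaseMatrix_succ_succ {m : ℕ} {x : Fin (m + 1) → ℝ} (hx : Monotone x) (κ : ℂ)
    (i : Fin m) : reducedPhaseMatrix m x κ i.succ i.succ =
      1 - Complex.exp (2 * Complex.I * κ * ((x i.succ - x i.castSucc : ℝ) : ℂ)) := by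
  simp only [reducedPhaseMatrix, Matrix.of_apply, Fin.cons_succ]
  rw [phaseMatrix_apply_of_le hx κ le_rfl,
    phaseMatrix_apply_of_ge hx κ (Fin.castSucc_lt_succ (i := i)).le, ← Complex.exp_add,
    sub_self, Complex.ofReal_zero, mul_zero, Complex.exp_zero]
  congr 2
  ring

/-- The determinant of the phase matrix:
`det Φₙ(κ) = ∏_{j=1}^{n−1} (1 − e^{2iκ(x_{j+1} − x_j)})`. -/
theorem phaseMatrix_det
    (n : ℕ) (hn : 1 ≤ n) (x : Fin n → ℝ) (hx : Monotone x) (κ : ℂ) :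
    (phaseMatrix n x κ).det =
      ∏ j : Fin (n - 1),
        (1 - Complex.exp (2 * Complex.I * κ *
          ((x ⟨(j : ℕ) + 1, by have := j.isLt; omega⟩ -
            x ⟨(j : ℕ), by have := j.isLt; omega⟩ : ℝ) : ℂ))) := by
  obtain ⟨m, rfl⟩ := Nat.exists_eq_add_of_le' hn
  rw [det_phaseMatrix_eq_det_reducedPhaseMatrix,
    Matrix.det_of_isUpperTriangular (reducedPhaseMatrix_isUpperTriangular hx κ), Fin.prod_univ_succ,
    reducedPhaseMatrix_zero_zero, one_mul]
  exact Finset.prod_congr rfl fun i _ => reducedPhaseMatrix_succ_succ hx κ i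
end

section
/- Let x₁ ≤ x₂ ≤ … ≤ xₙ be real numbers with n ≥ 2 and let k ∈ ℝ. Then det Φₙ(k + i·0) = 0 (equivalently, 0 is an eigenvalue of the phase matrix Φₙ(k)) if and only if there exist an index j ∈ {1,…,n−1} and an integer ν ∈ ℤ such that k·(x_{j+1} − x_j) = ν·π. -/
open Complex Matrix

/-- Subtracting a multiple of the second row from the first decouples the first point. -/
theorem phaseMatrix_det_succ_succ (m : ℕ) (x : Fin (m + 2) → ℝ) (hx : Monotone x) (κ : ℂ) :
    (phaseMatrix (m + 2) x κ).det =
      (1 - exp (2 * I * κ * ((x 1 - x 0 : ℝ) : ℂ))) *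
        (phaseMatrix (m + 1) (fun i => x i.succ) κ).det := by
  rw [← Matrix.det_updateRow_add_smul_self (phaseMatrix (m + 2) x κ)
    (show (0 : Fin (m + 2)) ≠ 1 from Fin.zero_ne_one)
    (-exp (I * κ * ((x 1 - x 0 : ℝ) : ℂ))), Matrix.det_succ_row_zero, Fin.sum_univ_succ,
    Finset.sum_eq_zero, add_zero]
  · have h01 : x 0 ≤ x 1 := hx (Fin.zero_le _)
    congr 1
    · simp only [phaseMatrix, Matrix.updateRow_self, Pi.add_apply, Pi.smul_apply,
        Matrix.of_apply, smul_eq_mul, abs_of_nonneg (sub_nonneg.2 h01), sub_self, abs_zero,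
        Fin.val_zero, pow_zero, one_mul, ofReal_zero, mul_zero, exp_zero, neg_mul, ← exp_add]
      rw [← sub_eq_add_neg]
      congr 2
      ring
  · intro j _
    have h0 : x 0 ≤ x j.succ := hx (Fin.zero_le _)
    have h1 : x 1 ≤ x j.succ := hx (by simp [Fin.le_def])
    have hz : phaseMatrix (m + 2) x κ 0 j.succ +
        -exp (I * κ * ((x 1 - x 0 : ℝ) : ℂ)) * phaseMatrix (m + 2) x κ 1 j.succ = 0 := by
      simp only [phaseMatrix, Matrix.of_apply, abs_of_nonpos (sub_nonpos.2 h0),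
        abs_of_nonpos (sub_nonpos.2 h1), neg_mul, ← exp_add]
      rw [← sub_eq_add_neg, sub_eq_zero]
      congr 1
      push_cast
      ring
    rw [Matrix.updateRow_self, Pi.add_apply, Pi.smul_apply, smul_eq_mul, hz, mul_zero, zero_mul]

/-- The determinant of the phase matrix is a product over consecutive gaps. -/
theorem phaseMatrix_det_succ (m : ℕ) (x : Fin (m + 1) → ℝ) (hx : Monotone x) (κ : ℂ) :
    (phaseMatrix (m + 1) x κ).det =
      ∏ j : Fin m, (1 - exp (2 * I * κ * ((x j.succ - x j.castSucc : ℝ) : ℂ))) := by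
  induction m with
  | zero => simp [phaseMatrix]
  | succ m ih =>
    rw [phaseMatrix_det_succ_succ m x hx, ih _ (fun a b h => hx (Fin.succ_le_succ_iff.2 h)),
      Fin.prod_univ_succ]
    rfl

theorem one_sub_exp_two_mul_I_eq_zero_iff (k d : ℝ) :
    1 - exp (2 * I * (k : ℂ) * (d : ℂ)) = 0 ↔ ∃ ν : ℤ, k * d = ν * Real.pi := by
  rw [sub_eq_zero, eq_comm, Complex.exp_eq_one_iff]
  refine exists_congr fun ν => ?_
  have h2I : (2 * I : ℂ) ≠ 0 := mul_ne_zero two_ne_zero I_ne_zero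
  rw [← Complex.ofReal_inj]
  push_cast
  exact ⟨fun h => mul_left_cancel₀ h2I (by linear_combination h),
    fun h => by linear_combination 2 * I * h⟩

/-- For real momentum `k`, `det Φₙ(k) = 0` (i.e. `0` is an eigenvalue of the
phase matrix) if and only if `k` resonates with some consecutive pair of atoms:
`k·(x_{j+1} − x_j) = ν·π` for some `j ∈ {1,…,n−1}` and `ν ∈ ℤ`. -/
theorem phaseMatrix_det_eq_zero_iff_resonance
    (n : ℕ) (hn : 2 ≤ n) (x : Fin n → ℝ) (hx : Monotone x) (k : ℝ) :
    (phaseMatrix n x (k : ℂ)).det = 0 ↔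
      ∃ j : Fin (n - 1), ∃ ν : ℤ,
        k * (x ⟨(j : ℕ) + 1, by have := j.isLt; omega⟩ -
              x ⟨(j : ℕ), by have := j.isLt; omega⟩) = ν * Real.pi := by
  obtain ⟨m, rfl⟩ : ∃ m, n = m + 1 := ⟨n - 1, by omega⟩
  rw [phaseMatrix_det_succ m x hx, Finset.prod_eq_zero_iff]
  simp only [Finset.mem_univ, true_and, one_sub_exp_two_mul_I_eq_zero_iff]
  rfl
end

section
/- Let x₁ ≤ x₂ ≤ … ≤ xₙ be real numbers with n ≥ 2, let k ∈ ℝ, and suppose there are j ∈ {1,…,n−1} and ν ∈ ℤ with k·(x_{j+1} − x_j) = ν·π. Then the vector e ∈ ℂⁿ with components e_j = 1, e_{j+1} = (−1)^{ν+1}, and e_ℓ = 0 for ℓ ∉ {j, j+1}, lies in the kernel of the phase matrix: Φₙ(k)·e = 0. -/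
open Complex Matrix

/-- Lengthening a real distance `a` by `b - a` with `k (b - a) = νπ` multiplies the phase
`exp(ika)` by `(-1)^ν`. -/
theorem phase_eq_neg_one_zpow_mul_phase {k a b : ℝ} {ν : ℤ} (h : k * (b - a) = ν * Real.pi) :
    Complex.exp (Complex.I * k * b) = (-1 : ℂ) ^ ν * Complex.exp (Complex.I * k * a) := by
  have hc : (k : ℂ) * (b - a) = ν * Real.pi := by exact_mod_cast h
  rw [← Complex.exp_pi_mul_I, ← Complex.exp_int_mul, ← Complex.exp_add]
  congr 1
  linear_combination Complex.I * hc

/-- If `k` resonates with the consecutive pair of atoms `(j, j+1)`, i.e.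
`k·(x_{j+1} − x_j) = ν·π`, then the vector with components `1` at `j`, `(−1)^{ν+1}` at `j+1`
and `0` elsewhere lies in the kernel of the phase matrix `Φₙ(k)`. -/
theorem resonant_pair_vector_in_kernel
    (n : ℕ) (hn : 2 ≤ n) (x : Fin n → ℝ) (hx : Monotone x) (k : ℝ)
    (j : Fin n) (hj : (j : ℕ) + 1 < n) (ν : ℤ)
    (hres : k * (x ⟨(j : ℕ) + 1, hj⟩ - x j) = ν * Real.pi) :
    (phaseMatrix n x (k : ℂ)).mulVec
      (fun ℓ => if ℓ = j then 1
        else if ℓ = (⟨(j : ℕ) + 1, hj⟩ : Fin n) then (-1 : ℂ) ^ (ν + 1) else 0) = 0 := by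
  set j' : Fin n := ⟨(j : ℕ) + 1, hj⟩ with hj'
  have hne : j' ≠ j := by simp [hj', Fin.ext_iff]
  have hvec : (fun ℓ => if ℓ = j then 1 else if ℓ = j' then (-1 : ℂ) ^ (ν + 1) else 0) =
      Pi.single j 1 + Pi.single j' ((-1 : ℂ) ^ (ν + 1)) := by
    ext ℓ
    by_cases h : ℓ = j
    · simp [h, hne.symm]
    · simp [h, Pi.single_apply]
  have hsq : (-1 : ℂ) ^ ν * (-1) ^ ν = 1 := by
    rw [← mul_zpow]
    simp
  have hsucc : (-1 : ℂ) ^ (ν + 1) = -(-1) ^ ν := by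
    rw [zpow_add_one₀ (by norm_num)]
    ring
  have hjj' : x j ≤ x j' := hx (by simp [hj', Fin.le_def])
  rw [hvec, Matrix.mulVec_add]
  ext m
  simp only [Pi.add_apply, Matrix.mulVec_single, Matrix.col_apply, Pi.smul_apply,
    MulOpposite.smul_eq_mul_unop, MulOpposite.unop_op, phaseMatrix, Matrix.of_apply,
    Pi.zero_apply, mul_one, hsucc]
  rcases le_or_gt m j with hm | hm
  · have hmj : x m ≤ x j := hx hm
    have hdist : k * (|x m - x j'| - |x m - x j|) = ν * Real.pi := by
      rw [abs_of_nonpos (by linarith), abs_of_nonpos (by linarith)]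
      linarith
    rw [phase_eq_neg_one_zpow_mul_phase hdist]
    linear_combination -Complex.exp (Complex.I * k * (|x m - x j| : ℝ)) * hsq
  · have hmj : x j' ≤ x m := hx (by simpa [hj', Fin.le_def] using hm)
    have hdist : k * (|x m - x j| - |x m - x j'|) = ν * Real.pi := by
      rw [abs_of_nonneg (by linarith), abs_of_nonneg (by linarith)]
      linarith
    rw [phase_eq_neg_one_zpow_mul_phase hdist]
    ring
end

section
/- Let x₁,…,xₙ be real numbers, k ∈ ℝ, and η ≥ 0. Then every eigenvalue λ ∈ ℂ of the phase matrix Φₙ(k+iη) satisfies 0 ≤ Re λ ≤ n. -/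
open Complex Matrix

/-- The kernel `min s t` is positive semidefinite on the nonnegative reals. -/
theorem sum_sum_mul_min_nonneg {ι : Type*} [Fintype ι] (s c : ι → ℝ) (hs : ∀ i, 0 ≤ s i) :
    0 ≤ ∑ i, ∑ j, c i * c j * min (s i) (s j) := by
  let f : ι → ι → ℝ → ℝ := fun i j =>
    (Set.Ioc 0 (min (s i) (s j))).indicator fun _ => c i * c j
  have hf_int (i j : ι) : MeasureTheory.Integrable (f i j) := by
    rw [MeasureTheory.integrable_indicator_iff measurableSet_Ioc]
    exact MeasureTheory.integrableOn_const (by simp)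
  have hf (i j : ι) : ∫ u, f i j u = c i * c j * min (s i) (s j) := by
    rw [MeasureTheory.integral_indicator measurableSet_Ioc]
    simp [hs i, hs j, mul_comm]
  have hf_mul (i j : ι) (u : ℝ) : f i j u =
      (Set.Ioc 0 (s i)).indicator (fun _ => c i) u *
        (Set.Ioc 0 (s j)).indicator (fun _ => c j) u := by
    simp only [f, Set.indicator_apply, Set.mem_Ioc, le_min_iff]
    split_ifs <;> first | rfl | tauto | simp
  calc
    0 ≤ ∫ u, ∑ i, ∑ j, f i j u := by
      refine MeasureTheory.integral_nonneg fun u => ?_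
      simp only [hf_mul, ← Finset.sum_mul_sum]
      exact mul_self_nonneg _
    _ = ∑ i, ∑ j, c i * c j * min (s i) (s j) := by
      rw [MeasureTheory.integral_finsetSum _ fun i _ =>
        MeasureTheory.integrable_finsetSum _ fun j _ => hf_int i j]
      refine Finset.sum_congr rfl fun i _ => ?_
      rw [MeasureTheory.integral_finsetSum _ fun j _ => hf_int i j]
      simp only [hf]

theorem exp_neg_mul_abs_sub_eq {η : ℝ} (hη : 0 ≤ η) (x y : ℝ) :
    Real.exp (-(η * |x - y|)) = Real.exp (-(η * x)) * Real.exp (-(η * y)) *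
      min (Real.exp (2 * (η * x))) (Real.exp (2 * (η * y))) := by
  rcases le_total x y with hxy | hxy
  · have := mul_le_mul_of_nonneg_left hxy hη
    rw [min_eq_left (Real.exp_le_exp.2 (by linarith)), ← Real.exp_add, ← Real.exp_add,
      abs_of_nonpos (by linarith)]
    ring_nf
  · have := mul_le_mul_of_nonneg_left hxy hη
    rw [min_eq_right (Real.exp_le_exp.2 (by linarith)), ← Real.exp_add, ← Real.exp_add,
      abs_of_nonneg (by linarith)]
    ring_nf

/-- The kernel `exp (-η |x - y|)` is positive semidefinite. -/
theorem sum_sum_mul_exp_neg_nonneg {ι : Type*} [Fintype ι] (x c : ι → ℝ) {η : ℝ} (hη : 0 ≤ η) :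
    0 ≤ ∑ i, ∑ j, c i * c j * Real.exp (-(η * |x i - x j|)) := by
  refine (sum_sum_mul_min_nonneg (fun i => Real.exp (2 * (η * x i)))
    (fun i => c i * Real.exp (-(η * x i))) fun i => (Real.exp_pos _).le).trans_eq ?_
  refine Finset.sum_congr rfl fun i _ => Finset.sum_congr rfl fun j _ => ?_
  rw [exp_neg_mul_abs_sub_eq hη]
  ring

/-- The kernel `exp (-η |x - y|) cos (k (x - y))` is positive semidefinite. -/
theorem sum_sum_mul_exp_neg_mul_cos_nonneg {ι : Type*} [Fintype ι] (x c : ι → ℝ) (k : ℝ) {η : ℝ}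
    (hη : 0 ≤ η) :
    0 ≤ ∑ i, ∑ j, c i * c j * (Real.exp (-(η * |x i - x j|)) * Real.cos (k * |x i - x j|)) := by
  refine (add_nonneg
    (sum_sum_mul_exp_neg_nonneg x (fun i => c i * Real.cos (k * x i)) hη)
    (sum_sum_mul_exp_neg_nonneg x (fun i => c i * Real.sin (k * x i)) hη)).trans_eq ?_
  simp only [← Finset.sum_add_distrib]
  refine Finset.sum_congr rfl fun i _ => Finset.sum_congr rfl fun j _ => ?_
  have hcos : Real.cos (k * |x i - x j|) = Real.cos (k * x i - k * x j) := by
    rcases abs_choice (x i - x j) with h | h <;> rw [h]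
    · rw [mul_sub]
    · rw [mul_neg, Real.cos_neg, mul_sub]
  rw [hcos, Real.cos_sub]
  ring

theorem phaseMatrix_apply_re (n : ℕ) (x : Fin n → ℝ) (k η : ℝ) (i j : Fin n) :
    (phaseMatrix n x (k + η * I) i j).re =
      Real.exp (-(η * |x i - x j|)) * Real.cos (k * |x i - x j|) := by
  simp [phaseMatrix, Complex.exp_re]

theorem phaseMatrix_apply_comm (n : ℕ) (x : Fin n → ℝ) (κ : ℂ) (i j : Fin n) :
    phaseMatrix n x κ i j = phaseMatrix n x κ j i := by
  simp [phaseMatrix, abs_sub_comm (x i)]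

/-- For a complex symmetric matrix, the real part of the quadratic form is the quadratic form of
the entrywise real part. -/
theorem re_mul_sum_normSq_of_mulVec_eq_smul {ι : Type*} [Fintype ι] {M : Matrix ι ι ℂ}
    (hM : ∀ i j, M i j = M j i) {v : ι → ℂ} {μ : ℂ} (hv : M *ᵥ v = μ • v) :
    μ.re * ∑ i, normSq (v i) =
      ∑ i, ∑ j, (M i j).re * ((v i).re * (v j).re + (v i).im * (v j).im) := by
  have hanti : ∑ i, ∑ j, (M i j).im * ((v i).re * (v j).im - (v i).im * (v j).re) = 0 := by
    refine self_eq_neg.1 ?_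
    conv_lhs => rw [Finset.sum_comm]
    simp only [← Finset.sum_neg_distrib]
    refine Finset.sum_congr rfl fun i _ => Finset.sum_congr rfl fun j _ => ?_
    rw [hM]
    ring
  have hform (i : ι) : μ.re * normSq (v i) = ∑ j, (star (v i) * (M i j * v j)).re := by
    rw [← Complex.re_sum, ← Finset.mul_sum]
    have hi : ∑ j, M i j * v j = μ * v i := congrFun hv i
    rw [hi]
    simp [normSq_apply]
    ring
  rw [Finset.mul_sum, ← sub_zero (∑ i, ∑ j, _), ← hanti]
  simp only [hform, ← Finset.sum_sub_distrib]
  refine Finset.sum_congr rfl fun i _ => Finset.sum_congr rfl fun j _ => ?_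
  simp
  ring

/-- Every eigenvalue `λ` of the phase matrix `Φₙ(k + iη)` with `η ≥ 0`
(a root of its characteristic polynomial) satisfies `0 ≤ Re λ ≤ n`. -/
theorem phaseMatrix_eigenvalue_re_bounds
    (n : ℕ) (x : Fin n → ℝ) (k η : ℝ) (hη : 0 ≤ η) (lam : ℂ)
    (h : (phaseMatrix n x ((k : ℂ) + (η : ℂ) * Complex.I) -
      lam • (1 : Matrix (Fin n) (Fin n) ℂ)).det = 0) :
    0 ≤ lam.re ∧ lam.re ≤ n := by
  obtain ⟨v, hv0, hv⟩ := Matrix.exists_mulVec_eq_zero_iff.2 h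
  rw [Matrix.sub_mulVec, Matrix.smul_mulVec, Matrix.one_mulVec, sub_eq_zero] at hv
  have hre := re_mul_sum_normSq_of_mulVec_eq_smul (phaseMatrix_apply_comm n x _) hv
  simp only [phaseMatrix_apply_re] at hre
  have hpos : 0 < ∑ i, normSq (v i) := by
    obtain ⟨i, hi⟩ := Function.ne_iff.1 hv0
    exact Finset.sum_pos' (fun i _ => normSq_nonneg _) ⟨i, Finset.mem_univ i, normSq_pos.2 hi⟩
  constructor
  · refine nonneg_of_mul_nonneg_left ?_ hpos
    rw [hre]
    refine (add_nonneg
      (sum_sum_mul_exp_neg_mul_cos_nonneg x (fun i => (v i).re) k hη)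
      (sum_sum_mul_exp_neg_mul_cos_nonneg x (fun i => (v i).im) k hη)).trans_eq ?_
    simp only [← Finset.sum_add_distrib]
    refine Finset.sum_congr rfl fun i _ => Finset.sum_congr rfl fun j _ => ?_
    ring
  · refine le_of_mul_le_mul_right ?_ hpos
    rw [hre]
    calc
      _ ≤ ∑ i, ∑ j, (normSq (v i) + normSq (v j)) / 2 := by
        refine Finset.sum_le_sum fun i _ => Finset.sum_le_sum fun j _ => ?_
        have hent : |Real.exp (-(η * |x i - x j|)) * Real.cos (k * |x i - x j|)| ≤ 1 := by
          rw [abs_mul, Real.abs_exp]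
          exact mul_le_one₀ (Real.exp_le_one_iff.2 (neg_nonpos.2 (by positivity)))
            (abs_nonneg _) (Real.abs_cos_le_one _)
        refine (le_abs_self _).trans ?_
        rw [abs_mul]
        refine (mul_le_of_le_one_left (abs_nonneg _) hent).trans ?_
        rw [normSq_apply, normSq_apply, abs_le]
        constructor <;>
          nlinarith [sq_nonneg ((v i).re - (v j).re), sq_nonneg ((v i).im - (v j).im),
            sq_nonneg ((v i).re + (v j).re), sq_nonneg ((v i).im + (v j).im)]
      _ = n * ∑ i, normSq (v i) := by
        simp only [← Finset.sum_div, Finset.sum_add_distrib, Finset.sum_const, Finset.card_univ,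
          Fintype.card_fin, nsmul_eq_mul, ← Finset.mul_sum]
        ring
end

section
/- Let d > 0, let x_j = (j−1)·d for j = 1,…,n with n ≥ 2, and let k = ν·π/d for some integer ν. Then for every a ∈ ℂⁿ one has Φₙ(k)·a = 0 if and only if Σ_{j=1}^{n} ((−1)^{ν})^{j} · a_j = 0; in particular, the kernel of Φₙ(k) has dimension n − 1 (so 0 is an (n−1)-fold degenerate eigenvalue of the phase matrix of a regular atomic array at a resonant momentum). -/
open Complex Matrix

/-- The sign `(-1) ^ ν` is an involution, hence so are its powers. -/
lemma neg_one_zpow_pow_mul_self (ν : ℤ) (m : ℕ) :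
    ((-1 : ℂ) ^ ν) ^ m * ((-1 : ℂ) ^ ν) ^ m = 1 := by
  rw [← mul_pow, ← mul_zpow]
  simp

/-- At a resonant momentum, the plane wave takes the value `((-1) ^ ν) ^ m` at the lattice point
`m * d`. -/
lemma exp_I_mul_resonant (ν : ℤ) (m : ℕ) {d k : ℝ} (hd : d ≠ 0) (hk : k = ν * Real.pi / d) :
    Complex.exp (Complex.I * (k : ℂ) * ((m * d : ℝ) : ℂ)) = ((-1 : ℂ) ^ ν) ^ m := by
  have hd' : (d : ℂ) ≠ 0 := by exact_mod_cast hd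
  have h : Complex.I * (k : ℂ) * ((m * d : ℝ) : ℂ) = m * (ν * (Real.pi * Complex.I)) := by
    rw [hk]
    push_cast
    field_simp
  rw [h, Complex.exp_nat_mul, Complex.exp_int_mul, Complex.exp_pi_mul_I]

/-- At a resonant momentum, the phase matrix of a regular array is of rank one, with entries
`((-1) ^ ν) ^ j * ((-1) ^ ν) ^ ℓ`. -/
lemma phaseMatrix_regular_array_apply {n : ℕ} {d k : ℝ} (hd : d ≠ 0) (ν : ℤ)
    (hk : k = ν * Real.pi / d) {x : Fin n → ℝ} (hx : ∀ j : Fin n, x j = (j : ℕ) * d)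
    (j l : Fin n) :
    phaseMatrix n x (k : ℂ) j l = ((-1 : ℂ) ^ ν) ^ (j : ℕ) * ((-1 : ℂ) ^ ν) ^ (l : ℕ) := by
  have key : ∀ p q : Fin n, Complex.exp (Complex.I * (k : ℂ) * ((x p - x q : ℝ) : ℂ)) =
      ((-1 : ℂ) ^ ν) ^ (p : ℕ) * ((-1 : ℂ) ^ ν) ^ (q : ℕ) := by
    intro p q
    rw [Complex.ofReal_sub, mul_sub, Complex.exp_sub, hx, hx, exp_I_mul_resonant ν _ hd hk,
      exp_I_mul_resonant ν _ hd hk, div_eq_mul_inv,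
      inv_eq_of_mul_eq_one_left (neg_one_zpow_pow_mul_self ν q)]
  rw [phaseMatrix, Matrix.of_apply]
  rcases abs_choice (x j - x l) with h | h
  · rw [h, key]
  · rw [h, neg_sub, key, mul_comm]

/-- For a regular array `x_j = (j−1)d` (zero-indexed: `x j = j·d`) at a
resonant momentum `k = νπ/d`, a vector `a` is in the kernel of the phase matrix iff
`Σ_{j=1}^n ((−1)^ν)^j a_j = 0`; in particular the kernel has dimension `n − 1`, i.e. `0` is an
`(n−1)`-fold degenerate eigenvalue. -/
theorem phaseMatrix_kernel_regular_array
    (n : ℕ) (hn : 2 ≤ n) (d : ℝ) (hd : 0 < d) (ν : ℤ) (k : ℝ)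
    (hk : k = ν * Real.pi / d)
    (x : Fin n → ℝ) (hx : ∀ j : Fin n, x j = (j : ℕ) * d) :
    (∀ a : Fin n → ℂ,
      (phaseMatrix n x (k : ℂ)).mulVec a = 0 ↔
        ∑ j : Fin n, ((-1 : ℂ) ^ ν) ^ ((j : ℕ) + 1) * a j = 0) ∧
    Module.finrank ℂ (LinearMap.ker (phaseMatrix n x (k : ℂ)).mulVecLin) = n - 1 := by
  have hs : ∀ m : ℕ, ((-1 : ℂ) ^ ν) ^ m ≠ 0 := fun m =>
    left_ne_zero_of_mul_eq_one (neg_one_zpow_pow_mul_self ν m)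
  let w : Fin n → ℂ := fun j => ((-1 : ℂ) ^ ν) ^ ((j : ℕ) + 1)
  have hker : ∀ a : Fin n → ℂ, (phaseMatrix n x (k : ℂ)).mulVec a = 0 ↔
      ∑ j : Fin n, ((-1 : ℂ) ^ ν) ^ ((j : ℕ) + 1) * a j = 0 := by
    intro a
    have hsum : ∑ j : Fin n, ((-1 : ℂ) ^ ν) ^ ((j : ℕ) + 1) * a j =
        (-1 : ℂ) ^ ν * ∑ j : Fin n, ((-1 : ℂ) ^ ν) ^ (j : ℕ) * a j := by
      rw [Finset.mul_sum]
      exact Finset.sum_congr rfl fun j _ => by ring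
    have hmul : ∀ j, (phaseMatrix n x (k : ℂ)).mulVec a j =
        ((-1 : ℂ) ^ ν) ^ (j : ℕ) * ∑ l : Fin n, ((-1 : ℂ) ^ ν) ^ (l : ℕ) * a l := by
      intro j
      rw [Matrix.mulVec, dotProduct, Finset.mul_sum]
      exact Finset.sum_congr rfl fun l _ => by
        rw [phaseMatrix_regular_array_apply hd.ne' ν hk hx, mul_assoc]
    have hν : (-1 : ℂ) ^ ν ≠ 0 := by simpa using hs 1
    rw [hsum, mul_eq_zero_iff_left hν]
    constructor
    · intro h
      have h0 := congrFun h ⟨0, by omega⟩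
      rw [hmul] at h0
      exact (mul_eq_zero_iff_left (hs _)).mp h0
    · intro h
      funext j
      rw [hmul, h, mul_zero, Pi.zero_apply]
  refine ⟨hker, ?_⟩
  let f : Module.Dual ℂ (Fin n → ℂ) := dotProductBilin ℂ ℂ w
  have hf : f ≠ 0 := by
    intro h
    have h0 := LinearMap.congr_fun h (Pi.single ⟨0, by omega⟩ 1)
    exact hs 1 (by simpa [f, w] using h0)
  have hkf : LinearMap.ker (phaseMatrix n x (k : ℂ)).mulVecLin = LinearMap.ker f := by
    ext a
    rw [LinearMap.mem_ker, LinearMap.mem_ker, Matrix.mulVecLin_apply]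
    exact hker a
  have hdim := Module.Dual.finrank_ker_add_one_of_ne_zero hf
  rw [Module.finrank_fin_fun] at hdim
  rw [hkf]
  omega
end
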